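/- arXiv:math/0601574 — 4 statements merged into one kernel-verified Lean document; each statement's English description precedes it below -/
import Mathlib

section
/- For positive integers q and q', the limit lim_{N→∞} (1/N) Σ_{n≤N} c_q(n) c_{q'}(n) exists and equals φ(q) if q = q', and equals 0 if q ≠ q', where φ is the Euler totient function. -/
open Finset Filter

/-- The Ramanujan sum `c_q(n) = ∑_{k=1, gcd(k,q)=1}^{q} e^{2πi k n / q}`. -/
noncomputable def ramanujanSum (q n : ℕ) : ℂ :=
  ∑ k ∈ (Finset.Icc 1 q).filter (fun k => Nat.gcd k q = 1),
    Complex.exp (2 * Real.pi * Complex.I * k * n / q)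

theorem injOn_exp_pow {q : ℕ} (hq : 0 < q) :
    Set.InjOn (fun k : ℕ => Complex.exp (2 * Real.pi * Complex.I / q) ^ k) (Finset.Icc 1 q) := by
  have hζ := Complex.isPrimitiveRoot_exp q hq.ne'
  intro i hi j hj h
  simp only [Finset.coe_Icc, Set.mem_Icc] at hi hj
  have hpred : Complex.exp (2 * Real.pi * Complex.I / q) ^ (i - 1) =
      Complex.exp (2 * Real.pi * Complex.I / q) ^ (j - 1) := by
    apply mul_right_cancel₀ (Complex.exp_ne_zero (2 * Real.pi * Complex.I / q))
    rw [← pow_succ, ← pow_succ, Nat.sub_add_cancel hi.1, Nat.sub_add_cancel hj.1]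
    exact h
  have := hζ.pow_inj (by omega) (by omega) hpred
  omega

/-- The exponentials of the fractions `k / q` with `k` prime to `q` are exactly the primitive
`q`-th roots of unity. -/
theorem image_exp_eq_primitiveRoots {q : ℕ} (hq : 0 < q) :
    ((Finset.Icc 1 q).filter (fun k => Nat.gcd k q = 1)).image
      (fun k => Complex.exp (2 * Real.pi * Complex.I / q) ^ k) = primitiveRoots q ℂ := by
  have hζ := Complex.isPrimitiveRoot_exp q hq.ne'
  apply Finset.eq_of_subset_of_card_le
  · intro x hx
    obtain ⟨k, hk, rfl⟩ := Finset.mem_image.1 hx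
    exact (mem_primitiveRoots hq).2 (hζ.pow_of_coprime k (Finset.mem_filter.1 hk).2)
  · rw [Complex.card_primitiveRoots, Finset.card_image_of_injOn
      ((injOn_exp_pow hq).mono (Finset.coe_subset.2 (Finset.filter_subset _ _))),
      ← Nat.filter_coprime_Ico_eq_totient q 1, add_comm 1 q, Finset.Ico_add_one_right_eq_Icc]
    simp only [Nat.coprime_comm (n := q), Nat.Coprime, le_refl]

theorem ramanujanSum_eq_sum_primitiveRoots {q : ℕ} (hq : 0 < q) (n : ℕ) :
    ramanujanSum q n = ∑ ζ ∈ primitiveRoots q ℂ, ζ ^ n := by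
  rw [← image_exp_eq_primitiveRoots hq, Finset.sum_image
    ((injOn_exp_pow hq).mono (Finset.coe_subset.2 (Finset.filter_subset _ _)))]
  refine Finset.sum_congr rfl fun k _ => ?_
  rw [← Complex.exp_nat_mul, ← Complex.exp_nat_mul]
  congr 1
  ring

/-- The powers of a complex number of modulus one have mean value `1` or `0`. -/
theorem tendsto_mean_pow {z : ℂ} (hz : ‖z‖ = 1) :
    Tendsto (fun N : ℕ => (1 / (N : ℂ)) * ∑ n ∈ Finset.Icc 1 N, z ^ n) atTop
      (nhds (if z = 1 then 1 else 0)) := by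
  split_ifs with h
  · refine tendsto_const_nhds.congr' ?_
    filter_upwards [eventually_gt_atTop 0] with N hN
    have : (N : ℂ) ≠ 0 := by exact_mod_cast hN.ne'
    simp [h, this]
  · have hbound (N : ℕ) : ‖∑ n ∈ Finset.Icc 1 N, z ^ n‖ ≤ 2 / ‖z - 1‖ := by
      have hpos : 0 < ‖z - 1‖ := norm_pos_iff.2 (sub_ne_zero.2 h)
      rw [← Finset.Ico_add_one_right_eq_Icc, geom_sum_Ico h (by omega), norm_div]
      gcongr
      exact (norm_sub_le _ _).trans (by simp [hz]; norm_num)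
    refine squeeze_zero_norm (a := fun N : ℕ => 2 / ‖z - 1‖ / N) (fun N => ?_)
      (tendsto_const_div_atTop_nhds_zero_nat _)
    rw [norm_mul, norm_div, norm_one, Complex.norm_natCast, one_div, inv_mul_eq_div]
    gcongr
    exact hbound N

theorem sum_primitiveRoots_ite_mul_eq_one {q q' : ℕ} (hq : 0 < q) (hq' : 0 < q') :
    (∑ ζ ∈ primitiveRoots q ℂ, ∑ ξ ∈ primitiveRoots q' ℂ, if ζ * ξ = 1 then (1 : ℂ) else 0) =
      if q = q' then (Nat.totient q : ℂ) else 0 := by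
  have hinner : ∀ ζ ∈ primitiveRoots q ℂ,
      (∑ ξ ∈ primitiveRoots q' ℂ, if ζ * ξ = 1 then (1 : ℂ) else 0) =
        if q = q' then 1 else 0 := by
    intro ζ hζ
    have hinv := ((mem_primitiveRoots hq).1 hζ).inv
    have hζ0 := ((mem_primitiveRoots hq).1 hζ).ne_zero hq.ne'
    have hiff (ξ : ℂ) : ζ * ξ = 1 ↔ ζ⁻¹ = ξ := by
      rw [mul_eq_one_iff_inv_eq₀ hζ0]
    have hmem : ζ⁻¹ ∈ primitiveRoots q' ℂ ↔ q = q' := by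
      rw [mem_primitiveRoots hq']
      exact ⟨fun h => hinv.unique h, fun h => h ▸ hinv⟩
    simp only [hiff, Finset.sum_ite_eq, hmem]
  rw [Finset.sum_congr rfl hinner, Finset.sum_const, Complex.card_primitiveRoots]
  simp

theorem meanValue_ramanujanSum_mul_ramanujanSum (q q' : ℕ) (hq : 0 < q) (hq' : 0 < q') :
    Tendsto
      (fun N : ℕ => (1 / (N : ℂ)) *
        ∑ n ∈ Finset.Icc 1 N, ramanujanSum q n * ramanujanSum q' n)
      atTop
      (nhds (if q = q' then (Nat.totient q : ℂ) else 0)) := by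
  rw [← sum_primitiveRoots_ite_mul_eq_one hq hq']
  have hlim : Tendsto (fun N : ℕ => ∑ ζ ∈ primitiveRoots q ℂ, ∑ ξ ∈ primitiveRoots q' ℂ,
      (1 / (N : ℂ)) * ∑ n ∈ Finset.Icc 1 N, (ζ * ξ) ^ n) atTop
      (nhds (∑ ζ ∈ primitiveRoots q ℂ, ∑ ξ ∈ primitiveRoots q' ℂ,
        if ζ * ξ = 1 then (1 : ℂ) else 0)) := by
    refine tendsto_finsetSum _ fun ζ hζ => tendsto_finsetSum _ fun ξ hξ => tendsto_mean_pow ?_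
    rw [norm_mul, ((mem_primitiveRoots hq).1 hζ).norm'_eq_one hq.ne',
      ((mem_primitiveRoots hq').1 hξ).norm'_eq_one hq'.ne', one_mul]
  refine hlim.congr fun N => ?_
  simp only [ramanujanSum_eq_sum_primitiveRoots hq, ramanujanSum_eq_sum_primitiveRoots hq',
    Finset.sum_mul_sum, ← mul_pow, ← Finset.mul_sum]
  congr 1
  rw [Finset.sum_comm]
  simp only [Finset.sum_comm (s := Finset.Icc 1 N)]
  rw [Finset.sum_comm]
end

section
/- For every positive integer h, Σ_{q=1}^∞ (μ²(q)/φ²(q)) c_q(h) = Π_p (1 + c_p(h)/(p−1)²), where the product is over all primes p; explicitly, the product equals Π_{p ∤ h} (1 − 1/(p−1)²) · Π_{p | h} (1 + 1/(p−1)). -/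
open Finset Filter ArithmeticFunction

/-- The exponential sum over all residues modulo `q` splits into Ramanujan sums over the
divisors of `q`. -/
theorem sum_divisors_ramanujanSum_eq_sum_exp {q : ℕ} (hq : q ≠ 0) (n : ℕ) :
    ∑ d ∈ q.divisors, ramanujanSum d n =
      ∑ k ∈ Finset.Icc 1 q, Complex.exp (2 * Real.pi * Complex.I * k * n / q) := by
  rw [← Nat.sum_div_divisors q (fun d => ramanujanSum d n),
    ← Finset.sum_fiberwise_of_maps_to (s := Finset.Icc 1 q) (t := q.divisors)
      (g := fun k => Nat.gcd k q) (fun k _ => by simp [hq, Nat.gcd_dvd_right])]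
  refine Finset.sum_congr rfl fun d hd => ?_
  obtain ⟨e, rfl⟩ := Nat.dvd_of_mem_divisors hd
  have hd0 : 0 < d := Nat.pos_of_ne_zero (left_ne_zero_of_mul hq)
  rw [Nat.mul_div_cancel_left _ hd0, ramanujanSum]
  refine Finset.sum_nbij (fun k => d * k) ?_ ?_ ?_ ?_
  · intro k hk
    simp only [Finset.mem_filter, Finset.mem_Icc] at hk ⊢
    exact ⟨⟨Nat.mul_pos hd0 hk.1.1, Nat.mul_le_mul_left d hk.1.2⟩, by
      rw [Nat.gcd_mul_left, hk.2, mul_one]⟩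
  · exact fun a _ b _ hab => Nat.eq_of_mul_eq_mul_left hd0 hab
  · intro k hk
    simp only [Finset.coe_filter, Finset.mem_Icc, Set.mem_ofPred_eq, Set.mem_image] at hk ⊢
    obtain ⟨⟨hk1, hk2⟩, hk3⟩ := hk
    obtain ⟨l, rfl⟩ : d ∣ k := hk3 ▸ Nat.gcd_dvd_left k (d * e)
    rw [Nat.gcd_mul_left] at hk3
    exact ⟨l, ⟨⟨Nat.pos_of_mul_pos_left hk1, Nat.le_of_mul_le_mul_left hk2 hd0⟩,
      Nat.eq_of_mul_eq_mul_left hd0 (by rw [hk3, mul_one])⟩, rfl⟩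
  · intro k _
    have hd' : (d : ℂ) ≠ 0 := by exact_mod_cast hd0.ne'
    have he' : (e : ℂ) ≠ 0 := by exact_mod_cast right_ne_zero_of_mul hq
    congr 1
    push_cast
    field_simp

/-- Orthogonality of additive characters modulo `q`. -/
theorem sum_exp_eq_ite_dvd {q : ℕ} (hq : q ≠ 0) (n : ℕ) :
    ∑ k ∈ Finset.Icc 1 q, Complex.exp (2 * Real.pi * Complex.I * k * n / q) =
      if q ∣ n then (q : ℂ) else 0 := by
  have hζ := Complex.isPrimitiveRoot_exp q hq
  set ζ := Complex.exp (2 * Real.pi * Complex.I / q) with hζdef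
  have hterm (k : ℕ) : Complex.exp (2 * Real.pi * Complex.I * k * n / q) = (ζ ^ n) ^ k := by
    rw [hζdef, ← Complex.exp_nat_mul, ← Complex.exp_nat_mul]
    congr 1
    ring
  simp_rw [hterm]
  split_ifs with hqn
  · simp [(hζ.pow_eq_one_iff_dvd n).2 hqn]
  · have hne : ζ ^ n - 1 ≠ 0 := sub_ne_zero.2 fun h1 => hqn ((hζ.pow_eq_one_iff_dvd n).1 h1)
    rw [← Finset.Ico_add_one_right_eq_Icc, Finset.sum_Ico_eq_sum_range]
    simp_rw [pow_add, ← Finset.mul_sum, Nat.add_sub_cancel]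
    refine mul_eq_zero_of_right _ ((mul_eq_zero.1 ?_).resolve_right hne)
    rw [geom_sum_mul, ← pow_mul, mul_comm n q, pow_mul, hζ.pow_eq_one, one_pow, sub_self]

theorem sum_divisors_ramanujanSum {q : ℕ} (hq : q ≠ 0) (n : ℕ) :
    ∑ d ∈ q.divisors, ramanujanSum d n = if q ∣ n then (q : ℂ) else 0 :=
  (sum_divisors_ramanujanSum_eq_sum_exp hq n).trans (sum_exp_eq_ite_dvd hq n)

@[simp]
theorem ramanujanSum_zero_left (n : ℕ) : ramanujanSum 0 n = 0 := by
  simp [ramanujanSum]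

@[simp]
theorem ramanujanSum_one_left (n : ℕ) : ramanujanSum 1 n = 1 := by
  simpa using sum_divisors_ramanujanSum one_ne_zero n

theorem ramanujanSum_prime {p : ℕ} (hp : p.Prime) (n : ℕ) :
    ramanujanSum p n = (if p ∣ n then (p : ℂ) else 0) - 1 := by
  have := sum_divisors_ramanujanSum hp.ne_zero n
  rw [hp.sum_divisors, ramanujanSum_one_left] at this
  exact eq_sub_of_add_eq this

/-- The Ramanujan sum `q ↦ c_q(n)` as an arithmetic function. -/
noncomputable def ramanujanSumArith (n : ℕ) : ArithmeticFunction ℂ :=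
  ⟨fun q => ramanujanSum q n, ramanujanSum_zero_left n⟩

/-- The arithmetic function equal to `q` on the divisors of `n` and to `0` elsewhere. -/
noncomputable def idOnDivisors (n : ℕ) : ArithmeticFunction ℂ :=
  ⟨fun q => if q ∣ n then (q : ℂ) else 0, by simp⟩

theorem isMultiplicative_idOnDivisors (n : ℕ) : (idOnDivisors n).IsMultiplicative := by
  refine ⟨by simp [idOnDivisors], fun {a b} hab => ?_⟩
  have hdvd : a * b ∣ n ↔ a ∣ n ∧ b ∣ n :=
    ⟨fun h => ⟨dvd_of_mul_right_dvd h, dvd_of_mul_left_dvd h⟩,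
      fun h => hab.mul_dvd_of_dvd_of_dvd h.1 h.2⟩
  by_cases ha : a ∣ n <;> by_cases hb : b ∣ n <;> simp [idOnDivisors, hdvd, ha, hb]

theorem isMultiplicative_ramanujanSumArith (n : ℕ) : (ramanujanSumArith n).IsMultiplicative := by
  have hconv : (zeta : ArithmeticFunction ℂ) * ramanujanSumArith n = idOnDivisors n := by
    ext q
    rcases eq_or_ne q 0 with rfl | hq
    · simp
    · rw [coe_zeta_mul_apply]
      exact sum_divisors_ramanujanSum hq n
  have heq : ramanujanSumArith n = (moebius : ArithmeticFunction ℂ) * idOnDivisors n := by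
    rw [← hconv, ← mul_assoc, coe_moebius_mul_coe_zeta, one_mul]
  rw [heq]
  exact isMultiplicative_moebius.intCast.mul (isMultiplicative_idOnDivisors n)

/-- The summand `μ²(q)/φ²(q) · c_q(n)` of the singular series as an arithmetic function. -/
noncomputable def singularSeriesTerm (n : ℕ) : ArithmeticFunction ℂ :=
  ⟨fun q => ((moebius q : ℂ) ^ 2 / (Nat.totient q : ℂ) ^ 2) * ramanujanSum q n, by simp⟩

theorem isMultiplicative_singularSeriesTerm (n : ℕ) :
    (singularSeriesTerm n).IsMultiplicative := by
  refine ⟨by simp [singularSeriesTerm], fun {a b} hab => ?_⟩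
  have hc : ramanujanSum (a * b) n = ramanujanSum a n * ramanujanSum b n :=
    (isMultiplicative_ramanujanSumArith n).map_mul_of_coprime hab
  simp only [singularSeriesTerm, coe_mk, hc, isMultiplicative_moebius.map_mul_of_coprime hab,
    Nat.totient_mul hab]
  push_cast
  ring

theorem singularSeriesTerm_prime {p : ℕ} (hp : p.Prime) (n : ℕ) :
    singularSeriesTerm n p = ramanujanSum p n / ((p : ℂ) - 1) ^ 2 := by
  simp only [singularSeriesTerm, coe_mk, moebius_apply_prime hp, Nat.totient_prime hp,
    Nat.cast_sub hp.one_le]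
  push_cast
  ring

theorem singularSeriesTerm_eq_zero_of_not_squarefree {q : ℕ} (hq : ¬Squarefree q) (n : ℕ) :
    singularSeriesTerm n q = 0 := by
  simp [singularSeriesTerm, moebius_eq_zero_of_not_squarefree hq]

theorem norm_ramanujanSum_prime_le {p n : ℕ} (hp : p.Prime) (hn : 0 < n) :
    ‖ramanujanSum p n‖ ≤ n := by
  rw [ramanujanSum_prime hp]
  split_ifs with hpn
  · rw [← Nat.cast_one, ← Nat.cast_sub hp.one_le, Complex.norm_natCast]
    exact_mod_cast (Nat.sub_le p 1).trans (Nat.le_of_dvd hn hpn)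
  · simpa using Nat.one_le_of_lt hn

theorem summable_norm_ramanujanSum_div_primes {n : ℕ} (hn : 0 < n) :
    Summable fun p : Nat.Primes => ‖ramanujanSum p n / ((p : ℂ) - 1) ^ 2‖ := by
  have hs : Summable fun p : Nat.Primes => 4 * (n : ℝ) * (1 / ((p : ℕ) : ℝ) ^ 2) :=
    ((Real.summable_one_div_nat_pow.2 one_lt_two).comp_injective
      Subtype.val_injective).mul_left _
  refine hs.of_nonneg_of_le (fun _ => norm_nonneg _) fun p => ?_
  have hp2 : (2 : ℝ) ≤ (p : ℕ) := by exact_mod_cast p.2.two_le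
  have hnorm : ‖((p : ℕ) : ℂ) - 1‖ = ((p : ℕ) : ℝ) - 1 := by
    rw [← Nat.cast_one, ← Nat.cast_sub p.2.one_le, Complex.norm_natCast,
      Nat.cast_sub p.2.one_le, Nat.cast_one]
  rw [norm_div, norm_pow, hnorm, mul_one_div,
    div_le_div_iff₀ (by nlinarith) (by positivity)]
  have hle := norm_ramanujanSum_prime_le p.2 hn
  have hsq : ((p : ℕ) : ℝ) ^ 2 ≤ 4 * (((p : ℕ) : ℝ) - 1) ^ 2 := by nlinarith
  calc _ ≤ (n : ℝ) * (4 * (((p : ℕ) : ℝ) - 1) ^ 2) := by gcongr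
    _ = _ := by ring

/-- A multiplicative function vanishing off the squarefree numbers, whose values at the primes
are absolutely summable, has the Euler product `∏ (1 + f p)`. -/
theorem tsum_eq_tprod_primes_one_add {f : ArithmeticFunction ℂ} (hf : f.IsMultiplicative)
    (hsq : ∀ q, ¬Squarefree q → f q = 0) (hsum : Summable fun p : Nat.Primes => ‖f p‖) :
    ∑' q, f q = ∏' p : Nat.Primes, (1 + f p) := by
  rw [tprod_one_add (summable_finsetProd_of_summable_norm hsum)]
  let ι : Nat.Primes ↪ ℕ := ⟨fun p => p, Nat.Primes.coe_nat_injective⟩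
  have hprod (s : Finset Nat.Primes) :
      ∏ p ∈ s, (p : ℕ) = ∏ p ∈ s.map ι, p :=
    (Finset.prod_map s ι fun p => p).symm
  have hprime (s : Finset Nat.Primes) :
      ∀ p ∈ s.map ι, p.Prime := by
    intro p hp
    obtain ⟨r, -, rfl⟩ := Finset.mem_map.1 hp
    exact r.2
  have hinj : Function.Injective fun s : Finset Nat.Primes => ∏ p ∈ s, (p : ℕ) := by
    intro s t hst
    simp only [hprod] at hst
    have := congrArg Nat.primeFactors hst
    rw [Nat.primeFactors_prod (hprime s), Nat.primeFactors_prod (hprime t)] at this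
    exact Finset.map_injective _ this
  rw [← hinj.tsum_eq]
  · refine tsum_congr fun s => ?_
    rw [hprod, hf.map_prod_of_prime _ (hprime s), Finset.prod_map]
    rfl
  · intro q hq
    have hq' : Squarefree q := by_contra fun h => hq (hsq q h)
    refine ⟨(q.primeFactors.subtype Nat.Prime : Finset Nat.Primes), ?_⟩
    conv_rhs => rw [← Nat.prod_primeFactors_of_squarefree hq']
    exact Finset.prod_subtype_of_mem (fun p => p) fun p hp => Nat.prime_of_mem_primeFactors hp

theorem tprod_one_add_ramanujanSum_primes {h : ℕ} (hh : 0 < h) :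
    (∏' p : Nat.Primes, (1 + ramanujanSum p h / ((p : ℂ) - 1) ^ 2))
      = (∏' p : {p : Nat.Primes // ¬ (p : ℕ) ∣ h}, (1 - 1 / (((p : ℕ) : ℂ) - 1) ^ 2)) *
        (∏ p ∈ h.primeFactors, (1 + 1 / ((p : ℂ) - 1))) := by
  set F : Nat.Primes → ℂ := fun p => 1 + ramanujanSum p h / ((p : ℂ) - 1) ^ 2 with hF
  let S : Finset Nat.Primes := h.primeFactors.subtype Nat.Prime
  have hmem (p : Nat.Primes) : p ∈ S ↔ (p : ℕ) ∣ h :=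
    Finset.mem_subtype.trans (by simp [Nat.mem_primeFactors, show (p : ℕ).Prime from p.2, hh.ne'])
  have hnot : HasProd (F ∘ (↑) : {p : Nat.Primes | ¬(p : ℕ) ∣ h} → ℂ)
      (∏' p : {p : Nat.Primes // ¬ (p : ℕ) ∣ h}, (1 - 1 / (((p : ℕ) : ℂ) - 1) ^ 2)) := by
    have hmul : Multipliable (F ∘ (↑) : {p : Nat.Primes | ¬(p : ℕ) ∣ h} → ℂ) :=
      multipliable_one_add_of_summable
        ((summable_norm_ramanujanSum_div_primes hh).comp_injective Subtype.val_injective)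
    convert! hmul.hasProd using 1
    refine tprod_congr fun p => ?_
    have hp : ¬((p : Nat.Primes) : ℕ) ∣ h := p.2
    simp only [hF, Function.comp_apply, ramanujanSum_prime p.1.2, if_neg hp]
    ring
  have hdvd : HasProd (F ∘ (↑) : ({p : Nat.Primes | ¬(p : ℕ) ∣ h}ᶜ : Set Nat.Primes) → ℂ)
      (∏ p ∈ h.primeFactors, (1 + 1 / ((p : ℂ) - 1))) := by
    have hset : ({p : Nat.Primes | ¬(p : ℕ) ∣ h}ᶜ : Set Nat.Primes)
        = S := by
      ext p
      simpa using (hmem p).symm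
    rw [hset]
    convert! S.hasProd F using 1
    rw [← Finset.prod_subtype_of_mem (fun p : ℕ => 1 + 1 / ((p : ℂ) - 1))
      fun p hp => Nat.prime_of_mem_primeFactors hp]
    refine Finset.prod_congr rfl fun p hp => ?_
    have hp1 : ((p : ℕ) : ℂ) - 1 ≠ 0 := sub_ne_zero.2 (by exact_mod_cast p.2.one_lt.ne')
    simp only [hF, ramanujanSum_prime p.2, if_pos ((hmem p).1 hp)]
    field_simp
  exact (hnot.mul_compl hdvd).tprod_eq

/-- Euler product for the singular series:
`∑_{q=1}^∞ (μ²(q)/φ²(q)) c_q(h) = ∏_p (1 + c_p(h)/(p−1)²)`, and explicitly this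
product equals `∏_{p ∤ h} (1 − 1/(p−1)²) · ∏_{p ∣ h} (1 + 1/(p−1))`.
(The term at `q = 0` of the series vanishes since `μ(0) = 0`.) -/
theorem singularSeries_eulerProduct (h : ℕ) (hh : 0 < h) :
    (∑' q : ℕ, ((moebius q : ℂ) ^ 2 / (Nat.totient q : ℂ) ^ 2) * ramanujanSum q h)
      = (∏' p : Nat.Primes, (1 + ramanujanSum p h / ((p : ℂ) - 1) ^ 2)) ∧
    (∏' p : Nat.Primes, (1 + ramanujanSum p h / ((p : ℂ) - 1) ^ 2))
      = (∏' p : {p : Nat.Primes // ¬ (p : ℕ) ∣ h}, (1 - 1 / (((p : ℕ) : ℂ) - 1) ^ 2)) *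
        (∏ p ∈ h.primeFactors, (1 + 1 / ((p : ℂ) - 1))) := by
  refine ⟨?_, tprod_one_add_ramanujanSum_primes hh⟩
  have hsum : Summable fun p : Nat.Primes => ‖singularSeriesTerm h p‖ := by
    refine (summable_norm_ramanujanSum_div_primes hh).congr fun p => ?_
    rw [singularSeriesTerm_prime p.2]
  refine (tsum_eq_tprod_primes_one_add (isMultiplicative_singularSeriesTerm h)
    (fun _ hq => singularSeriesTerm_eq_zero_of_not_squarefree hq h) hsum).trans ?_
  exact tprod_congr fun p => by rw [singularSeriesTerm_prime p.2]
end

section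
/- Let A = Π_{p>2} (1 − 1/(p−1)²), the product over odd primes. Then lim_{n→∞} (log n)² · Π_{2 < p ≤ √n} (1 − 2/p) = 16·A·e^{−2γ}, where the product runs over odd primes p ≤ √n and γ is the Euler–Mascheroni constant. -/
open Filter

/-- The twin prime constant `A = ∏_{p>2} (1 − 1/(p−1)²)`, product over odd primes. -/
noncomputable def twinPrimeConstant : ℝ :=
  ∏' p : {p : Nat.Primes // 2 < (p : ℕ)}, (1 - 1 / (((p : ℕ) : ℝ) - 1) ^ 2)

theorem Real.log_factorial_eq_sum_primesLE (n : ℕ) :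
    Real.log (n.factorial : ℝ) =
      ∑ p ∈ n.primesLE, (n.factorial.factorization p : ℝ) * Real.log p := by
  rw [Real.log_nat_eq_sum_factorization, Finsupp.sum_of_support_subset]
  · intro p hp
    rw [Nat.support_factorization, Nat.mem_primeFactors] at hp
    exact Nat.mem_primesLE.2 ⟨hp.1.dvd_factorial.1 hp.2.1, hp.1⟩
  · simp

theorem Nat.div_le_factorization_factorial {p : ℕ} (hp : p.Prime) (n : ℕ) :
    n / p ≤ n.factorial.factorization p := by
  rw [Nat.factorization_factorial hp (show Nat.log p n < Nat.log p n + 2 by lia)]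
  simpa using Finset.single_le_sum (f := fun i => n / p ^ i) (fun _ _ => Nat.zero_le _)
    (show 1 ∈ Finset.Ico 1 (Nat.log p n + 2) by simp)

theorem Real.log_factorial_le_mul_log (n : ℕ) : Real.log (n.factorial : ℝ) ≤ n * Real.log n := by
  rw [← Real.log_pow]
  exact Real.log_le_log (mod_cast n.factorial_pos) (mod_cast Nat.factorial_le_pow n)

theorem Real.mul_log_sub_self_le_log_factorial (n : ℕ) :
    n * Real.log n - n ≤ Real.log (n.factorial : ℝ) := by
  rcases n.eq_zero_or_pos with rfl | hn
  · simp
  have h := Real.pow_div_factorial_le_exp (n : ℝ) n.cast_nonneg n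
  have hn' : (0 : ℝ) < n := mod_cast hn
  have hf : (0 : ℝ) < n.factorial := mod_cast n.factorial_pos
  have := Real.log_le_log (by positivity) h
  rw [Real.log_exp, Real.log_div (by positivity) (by positivity), Real.log_pow] at this
  linarith

theorem summable_log_div_mul_sub_one :
    Summable (fun n : ℕ => Real.log n / (n * (n - 1))) := by
  have h : Summable (fun n : ℕ => 4 * (1 / (n : ℝ) ^ (3 / 2 : ℝ))) :=
    (Real.summable_one_div_nat_rpow.2 (by norm_num)).mul_left 4
  refine Summable.of_nonneg_of_le (fun n => ?_) (fun n => ?_) h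
  · rcases Nat.lt_or_ge n 2 with hn | hn
    · interval_cases n <;> simp
    · have : (2 : ℝ) ≤ n := mod_cast hn
      exact div_nonneg (Real.log_nonneg (by linarith)) (by nlinarith)
  · rcases Nat.lt_or_ge n 2 with hn | hn
    · interval_cases n <;> simp
    · have h2 : (2 : ℝ) ≤ n := mod_cast hn
      have h0 : (0 : ℝ) < n := by linarith
      have hl := Real.log_le_rpow_div h0.le (show (0 : ℝ) < 1 / 2 by norm_num)
      have hp : (n : ℝ) ^ (1 / 2 : ℝ) * (n : ℝ) ^ (3 / 2 : ℝ) = n ^ 2 := by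
        rw [← Real.rpow_add h0, ← Real.rpow_natCast]; norm_num
      have h3 : 0 < (n : ℝ) ^ (3 / 2 : ℝ) := by positivity
      rw [mul_one_div, div_le_div_iff₀ (by nlinarith) h3]
      calc Real.log n * (n : ℝ) ^ (3 / 2 : ℝ)
          ≤ ((n : ℝ) ^ (1 / 2 : ℝ) / (1 / 2)) * (n : ℝ) ^ (3 / 2 : ℝ) := by gcongr
        _ = 2 * ((n : ℝ) ^ (1 / 2 : ℝ) * (n : ℝ) ^ (3 / 2 : ℝ)) := by ring
        _ ≤ 4 * (n * (n - 1)) := by rw [hp]; nlinarith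

/-- **Mertens' first theorem**. -/
theorem exists_abs_sum_log_div_sub_log_le :
    ∃ C : ℝ, ∀ n : ℕ, 1 ≤ n →
      |∑ p ∈ n.primesLE, Real.log p / p - Real.log n| ≤ C := by
  set S : ℝ := ∑' n : ℕ, Real.log n / (n * (n - 1)) with hS
  refine ⟨max (Real.log 4) (1 + S), fun n hn => ?_⟩
  have hn0 : (0 : ℝ) < n := mod_cast hn
  have hupper : n * ∑ p ∈ n.primesLE, Real.log p / p ≤ n * (Real.log n + Real.log 4) := by
    have h1 : ∑ p ∈ n.primesLE, ((n : ℝ) / p - 1) * Real.log p ≤ n * Real.log n := by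
      refine le_trans ?_ (Real.log_factorial_le_mul_log n)
      rw [Real.log_factorial_eq_sum_primesLE]
      refine Finset.sum_le_sum fun p hp => ?_
      have hpp := Nat.prime_of_mem_primesLE hp
      refine mul_le_mul_of_nonneg_right ?_ (Real.log_natCast_nonneg p)
      have h2 : ((n / p : ℕ) : ℝ) ≤ n.factorial.factorization p :=
        mod_cast Nat.div_le_factorization_factorial hpp n
      have h3 := Nat.lt_floor_add_one ((n : ℝ) / p)
      rw [Nat.floor_div_eq_div] at h3
      linarith
    have h2 := Chebyshev.theta_le_log4_mul_x hn0.le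
    rw [Chebyshev.theta_eq_sum_primesLE_log] at h2
    have h3 : ∑ p ∈ n.primesLE, ((n : ℝ) / p - 1) * Real.log p =
        n * ∑ p ∈ n.primesLE, Real.log p / p - ∑ p ∈ n.primesLE, Real.log p := by
      rw [Finset.mul_sum, ← Finset.sum_sub_distrib]
      exact Finset.sum_congr rfl fun p _ => by ring
    linarith
  have hlower : n * (Real.log n - 1 - S) ≤ n * ∑ p ∈ n.primesLE, Real.log p / p := by
    have h1 : Real.log (n.factorial : ℝ) ≤
        ∑ p ∈ n.primesLE, (n * (Real.log p / p) + n * (Real.log p / (p * (p - 1)))) := by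
      rw [Real.log_factorial_eq_sum_primesLE]
      refine Finset.sum_le_sum fun p hp => ?_
      have hpp := Nat.prime_of_mem_primesLE hp
      have hp2 : (2 : ℝ) ≤ p := mod_cast hpp.two_le
      have h2 : (n.factorial.factorization p : ℝ) ≤ n / (p - 1) := by
        refine le_trans (Nat.cast_le.2 (Nat.factorization_factorial_le_div_pred hpp n)) ?_
        refine Nat.cast_div_le.trans_eq ?_
        rw [Nat.cast_sub hpp.one_le, Nat.cast_one]
      calc _ ≤ (n : ℝ) / (p - 1) * Real.log p :=
            mul_le_mul_of_nonneg_right h2 (Real.log_natCast_nonneg p)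
        _ = _ := by
            have : (p : ℝ) ≠ 0 := by linarith
            have : (p : ℝ) - 1 ≠ 0 := by linarith
            field_simp
            ring
    rw [Finset.sum_add_distrib, ← Finset.mul_sum, ← Finset.mul_sum] at h1
    have h2 : ∑ p ∈ n.primesLE, Real.log p / (p * (p - 1)) ≤ S := by
      refine summable_log_div_mul_sub_one.sum_le_tsum _ fun p _ => ?_
      rcases p.eq_zero_or_pos with rfl | hp
      · simp
      · have : (1 : ℝ) ≤ p := mod_cast hp
        exact div_nonneg (Real.log_natCast_nonneg p) (by nlinarith)
    have h3 := Real.mul_log_sub_self_le_log_factorial n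
    nlinarith
  have h1 := le_of_mul_le_mul_left hupper hn0
  have h2 := le_of_mul_le_mul_left hlower hn0
  rw [abs_le]
  constructor
  · linarith [le_max_right (Real.log 4) (1 + S)]
  · linarith [le_max_left (Real.log 4) (1 + S)]

theorem sum_primesLE_eq_sum_range {M : Type*} [AddCommMonoid M] (f : ℕ → M) (n : ℕ) :
    ∑ p ∈ (n + 1).primesLE, f p =
      ∑ i ∈ Finset.range n, if (i + 2).Prime then f (i + 2) else 0 := by
  rw [Nat.primesLE_eq_filter_range, Finset.sum_filter, Finset.sum_range_succ',
    Finset.sum_range_succ']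
  simp [Nat.not_prime_zero, Nat.not_prime_one, add_assoc]

theorem summable_log_sub_div_log_sub_log_log :
    Summable fun i : ℕ => (Real.log (i + 3) - Real.log (i + 2)) / Real.log (i + 3) -
      (Real.log (Real.log (i + 3)) - Real.log (Real.log (i + 2))) := by
  have key (i : ℕ) : 0 < Real.log ((i : ℝ) + 2) ∧ Real.log ((i : ℝ) + 2) ≤ Real.log (i + 3) ∧
      Real.log ((i : ℝ) + 3) - Real.log (i + 2) ≤ 1 := by
    have hi : (0 : ℝ) ≤ i := i.cast_nonneg
    refine ⟨Real.log_pos (by linarith), Real.log_le_log (by linarith) (by linarith), ?_⟩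
    rw [← Real.log_div (by linarith) (by linarith)]
    refine (Real.log_le_sub_one_of_pos (by positivity)).trans ?_
    rw [sub_le_iff_le_add, div_le_iff₀ (by linarith)]
    linarith
  have hsum : Summable fun i : ℕ => (Real.log ((i : ℝ) + 2))⁻¹ - (Real.log (i + 3))⁻¹ := by
    refine summable_of_sum_range_le (c := (Real.log 2)⁻¹) (fun i => ?_) (fun n => ?_)
    · obtain ⟨h1, h2, -⟩ := key i
      exact sub_nonneg.2 (inv_anti₀ h1 h2)
    · have := Finset.sum_range_sub' (fun i : ℕ => (Real.log ((i : ℝ) + 2))⁻¹) n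
      simp only [Nat.cast_add, Nat.cast_one, add_assoc,
        show (1 : ℝ) + 2 = 3 by norm_num] at this
      rw [this]
      have := (key n).1
      simp
      positivity
  refine Summable.of_norm_bounded hsum fun i => ?_
  obtain ⟨h1, h2, h3⟩ := key i
  set a := Real.log ((i : ℝ) + 2)
  set b := Real.log ((i : ℝ) + 3)
  have hb : 0 < b := h1.trans_le h2
  have hu : Real.log b - Real.log a ≤ (b - a) / a := by
    rw [← Real.log_div hb.ne' h1.ne', sub_div, div_self h1.ne']
    exact Real.log_le_sub_one_of_pos (by positivity)
  have hl : (b - a) / b ≤ Real.log b - Real.log a := by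
    rw [← Real.log_div hb.ne' h1.ne', sub_div, div_self hb.ne', ← inv_div b a]
    exact Real.one_sub_inv_le_log_of_pos (by positivity)
  rw [Real.norm_eq_abs, abs_le]
  have h4 : (b - a) / a - (b - a) / b ≤ a⁻¹ - b⁻¹ := by
    rw [div_eq_mul_inv, div_eq_mul_inv, ← mul_sub]
    exact mul_le_of_le_one_left (sub_nonneg.2 (inv_anti₀ h1 h2)) h3
  have h5 : b⁻¹ ≤ a⁻¹ := inv_anti₀ h1 h2
  constructor <;> linarith

/-- **Mertens' second theorem**, without the value of the constant. -/
theorem exists_tendsto_sum_inv_sub_log_log :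
    ∃ M : ℝ, Tendsto (fun n : ℕ => ∑ p ∈ n.primesLE, 1 / (p : ℝ) - Real.log (Real.log n))
      atTop (nhds M) := by
  obtain ⟨C, hC⟩ := exists_abs_sum_log_div_sub_log_le
  set z : ℕ → ℝ := fun i => (if (i + 2).Prime then Real.log ((i + 2 : ℕ) : ℝ) / ((i + 2 : ℕ) : ℝ)
    else 0) - (Real.log (i + 2) - Real.log (i + 1)) with hz
  have hpos (i : ℕ) : 0 < Real.log ((i : ℝ) + 2) :=
    Real.log_pos (by linarith [(i.cast_nonneg : (0 : ℝ) ≤ i)])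
  have hzsum (n : ℕ) : ‖∑ i ∈ Finset.range n, z i‖ ≤ C := by
    have h1 := Finset.sum_range_sub (fun i : ℕ => Real.log ((i : ℝ) + 1)) n
    simp only [Nat.cast_add, Nat.cast_one, add_assoc, one_add_one_eq_two] at h1
    have h2 := hC (n + 1) (by lia)
    rw [sum_primesLE_eq_sum_range] at h2
    rw [hz, Finset.sum_sub_distrib, h1]
    simpa using h2
  have hanti : Antitone fun i : ℕ => (Real.log ((i : ℝ) + 2))⁻¹ := by
    intro i j hij
    have : (i : ℝ) ≤ j := mod_cast hij
    exact inv_anti₀ (hpos i) (Real.log_le_log (by positivity) (by linarith))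
  have hlim : Tendsto (fun i : ℕ => (Real.log ((i : ℝ) + 2))⁻¹) atTop (nhds 0) :=
    tendsto_inv_atTop_zero.comp (Real.tendsto_log_atTop.comp
      (tendsto_atTop_add_const_right _ _ tendsto_natCast_atTop_atTop))
  obtain ⟨M₁, hM₁⟩ := cauchySeq_tendsto_of_complete
    (hanti.cauchySeq_series_mul_of_tendsto_zero_of_bounded hlim hzsum)
  have hM₂ := summable_log_sub_div_log_sub_log_log.hasSum.tendsto_sum_nat
  set M₂ := ∑' i : ℕ, ((Real.log ((i : ℝ) + 3) - Real.log (i + 2)) / Real.log (i + 3) -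
      (Real.log (Real.log (i + 3)) - Real.log (Real.log (i + 2))))
  refine ⟨M₁ + M₂ + 1 - Real.log (Real.log 2), ?_⟩
  rw [← tendsto_add_atTop_iff_nat 2]
  refine ((((hM₁.comp (tendsto_add_atTop_nat 1)).add hM₂).add_const 1).sub_const
    (Real.log (Real.log 2))).congr fun n => ?_
  have hz' (i : ℕ) : (Real.log ((i : ℝ) + 2))⁻¹ • z i =
      (if (i + 2).Prime then 1 / ((i + 2 : ℕ) : ℝ) else 0) -
        (Real.log (i + 2) - Real.log (i + 1)) / Real.log (i + 2) := by
    have := (hpos i).ne'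
    simp only [hz, smul_eq_mul]
    split_ifs
    · push_cast
      field_simp
    · field_simp
      ring
  have h1 := Finset.sum_range_sub (fun i : ℕ => Real.log (Real.log ((i : ℝ) + 2))) n
  simp only [Nat.cast_add, Nat.cast_one, add_assoc,
        show (1 : ℝ) + 2 = 3 by norm_num] at h1
  have h2 : ∑ i ∈ Finset.range (n + 1),
      (Real.log ((i : ℝ) + 2) - Real.log (i + 1)) / Real.log (i + 2) =
      ∑ i ∈ Finset.range n,
        (Real.log ((i : ℝ) + 3) - Real.log (i + 2)) / Real.log (i + 3) + 1 := by
    have := (Real.log_pos one_lt_two).ne'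
    rw [Finset.sum_range_succ']
    simp [add_assoc, one_add_one_eq_two, show (1 : ℝ) + 2 = 3 by norm_num, this]
  rw [show n + 2 = (n + 1) + 1 by rfl, sum_primesLE_eq_sum_range]
  simp only [Function.comp_apply, hz', Finset.sum_sub_distrib, h1, h2]
  push_cast
  rw [show (n : ℝ) + 1 + 1 = n + 2 by ring]
  simp
  ring

theorem tendsto_one_sub_two_rpow_neg_div :
    Tendsto (fun δ : ℝ => (1 - (2 : ℝ) ^ (-δ)) / δ) (nhdsWithin 0 (Set.Ioi 0))
      (nhds (Real.log 2)) := by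
  have h : HasDerivAt (fun δ : ℝ => 1 - (2 : ℝ) ^ (-δ)) (Real.log 2) 0 := by
    have := ((hasDerivAt_id (0 : ℝ)).neg.const_rpow (a := 2) two_pos).const_sub 1
    simpa using this
  have := h.tendsto_slope_zero_right
  simpa [div_eq_inv_mul] using this

/-- The partial sums of `f` and the sums of `f n * n ^ (-δ)`, grouped into dyadic blocks. -/
theorem tsum_dyadic_bounds {c : ℕ → ℝ} (hc : ∀ n, 0 ≤ c n) (hc0 : c 0 = 0) (hc1 : c 1 = 0)
    {δ Φ : ℝ} (hδ : 0 < δ) (h : HasSum (fun n : ℕ => c n * (n : ℝ) ^ (-δ)) Φ) :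
    ∃ P : ℝ, HasSum (fun k : ℕ => (∑ n ∈ Finset.Ico (2 ^ (k + 1)) (2 ^ (k + 2)), c n) *
      ((2 : ℝ) ^ (-δ)) ^ (k + 1)) P ∧ (2 : ℝ) ^ (-δ) * P ≤ Φ ∧ Φ ≤ P := by
  set q : ℝ := (2 : ℝ) ^ (-δ) with hq
  have hq0 : 0 < q := by positivity
  set E : ℕ → ℝ := fun k => ∑ n ∈ Finset.Ico (2 ^ (k + 1)) (2 ^ (k + 2)), c n * (n : ℝ) ^ (-δ)
    with hE
  have hEsum : HasSum E Φ := by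
    rw [hasSum_iff_tendsto_nat_of_nonneg
      (fun k => Finset.sum_nonneg fun n _ => mul_nonneg (hc n) (by positivity))]
    have h1 : Tendsto (fun K : ℕ => 2 ^ (K + 1)) atTop atTop :=
      (tendsto_pow_atTop_atTop_of_one_lt one_lt_two).comp (tendsto_add_atTop_nat 1)
    refine (h.tendsto_sum_nat.comp h1).congr fun K => ?_
    simp only [Function.comp_apply]
    induction K with
    | zero => simp [Finset.sum_range_succ, hc0, hc1]
    | succ K ih =>
      rw [Finset.sum_range_succ, ← ih, Finset.sum_range_add_sum_Ico]
      exact Nat.pow_le_pow_right two_pos (by lia)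
  have hpow (k : ℕ) : ((2 ^ k : ℕ) : ℝ) ^ (-δ) = q ^ k := by
    rw [hq, ← Real.rpow_natCast, ← Real.rpow_mul two_pos.le, mul_comm, Real.rpow_mul two_pos.le]
    simp
  have hup (k : ℕ) : E k ≤ (∑ n ∈ Finset.Ico (2 ^ (k + 1)) (2 ^ (k + 2)), c n) * q ^ (k + 1) := by
    rw [Finset.sum_mul]
    refine Finset.sum_le_sum fun n hn => mul_le_mul_of_nonneg_left ?_ (hc n)
    rw [← hpow]
    exact Real.rpow_le_rpow_of_nonpos (by positivity)
      (mod_cast (Finset.mem_Ico.1 hn).1) (by linarith)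
  have hlow (k : ℕ) :
      q * ((∑ n ∈ Finset.Ico (2 ^ (k + 1)) (2 ^ (k + 2)), c n) * q ^ (k + 1)) ≤ E k := by
    rw [mul_left_comm, ← pow_succ', Finset.sum_mul]
    refine Finset.sum_le_sum fun n hn => mul_le_mul_of_nonneg_left ?_ (hc n)
    rw [← hpow]
    have hn' := Finset.mem_Ico.1 hn
    have : 0 < n := (Nat.two_pow_pos _).trans_le hn'.1
    exact Real.rpow_le_rpow_of_nonpos (by positivity) (mod_cast hn'.2.le) (by linarith)
  have hs : Summable (fun k : ℕ => (∑ n ∈ Finset.Ico (2 ^ (k + 1)) (2 ^ (k + 2)), c n) *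
      q ^ (k + 1)) := by
    refine Summable.of_nonneg_of_le
      (fun k => mul_nonneg (Finset.sum_nonneg fun n _ => hc n) (by positivity)) (fun k => ?_)
      (hEsum.summable.mul_left q⁻¹)
    rw [← div_eq_inv_mul, le_div_iff₀' hq0]
    exact hlow k
  exact ⟨_, hs.hasSum, hasSum_le hlow (hs.hasSum.mul_left q) hEsum, hasSum_le hup hEsum hs.hasSum⟩

theorem tendsto_dyadic_sum_sub {c : ℕ → ℝ} (hc0 : c 0 = 0) (hc1 : c 1 = 0) {M : ℝ}
    (h : Tendsto (fun n : ℕ => ∑ i ∈ Finset.range n, c i - Real.log (Real.log n)) atTop (nhds M)) :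
    Tendsto (fun K : ℕ => ∑ k ∈ Finset.range K,
      (∑ n ∈ Finset.Ico (2 ^ (k + 1)) (2 ^ (k + 2)), c n - 1 / ((k : ℝ) + 1))) atTop
      (nhds (M + Real.log (Real.log 2) - Real.eulerMascheroniConstant)) := by
  have h1 : Tendsto (fun K : ℕ => 2 ^ (K + 1)) atTop atTop :=
    (tendsto_pow_atTop_atTop_of_one_lt one_lt_two).comp (tendsto_add_atTop_nat 1)
  refine (((h.comp h1).add_const (Real.log (Real.log 2))).sub
    Real.tendsto_harmonic_sub_log_add_one).congr fun K => ?_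
  have hblock : ∑ k ∈ Finset.range K, ∑ n ∈ Finset.Ico (2 ^ (k + 1)) (2 ^ (k + 2)), c n =
      ∑ i ∈ Finset.range (2 ^ (K + 1)), c i := by
    induction K with
    | zero => simp [Finset.sum_range_succ, hc0, hc1]
    | succ K ih =>
      rw [Finset.sum_range_succ, ih, Finset.sum_range_add_sum_Ico]
      exact Nat.pow_le_pow_right two_pos (by lia)
  have hl : Real.log (Real.log ((2 ^ (K + 1) : ℕ) : ℝ)) =
      Real.log (K + 1) + Real.log (Real.log 2) := by
    rw [Nat.cast_pow, Real.log_pow, Nat.cast_ofNat,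
      Real.log_mul (by positivity) (Real.log_pos one_lt_two).ne']
    norm_num
  rw [Finset.sum_sub_distrib, hblock]
  simp only [Function.comp_apply, hl, harmonic]
  push_cast
  simp only [one_div]
  ring

/-- If `∑ n < N, c n = log log N + M + o(1)`, the constant `M` can be read off from the
behaviour of the Dirichlet series of `c` at `0`. -/
theorem const_eq_of_tendsto_dirichlet {c : ℕ → ℝ} (hc : ∀ n, 0 ≤ c n) (hc0 : c 0 = 0)
    (hc1 : c 1 = 0) {M L : ℝ} {Φ : ℝ → ℝ}
    (h : Tendsto (fun n : ℕ => ∑ i ∈ Finset.range n, c i - Real.log (Real.log n)) atTop (nhds M))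
    (hΦ : ∀ δ, 0 < δ → HasSum (fun n : ℕ => c n * (n : ℝ) ^ (-δ)) (Φ δ))
    (hL : Tendsto (fun δ => Φ δ + Real.log δ) (nhdsWithin 0 (Set.Ioi 0)) (nhds L)) :
    M = Real.eulerMascheroniConstant + L := by
  have hP (δ : ℝ) (hδ : 0 < δ) := tsum_dyadic_bounds hc hc0 hc1 hδ (hΦ δ hδ)
  choose! P hPsum hPl hPu using hP
  set B : ℕ → ℝ := fun k => ∑ n ∈ Finset.Ico (2 ^ (k + 1)) (2 ^ (k + 2)), c n with hB
  set q : ℝ → ℝ := fun δ => (2 : ℝ) ^ (-δ) with hq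
  have hqlim : Tendsto q (nhdsWithin 0 (Set.Ioi 0)) (nhds 1) := by
    have : Continuous q := by fun_prop (disch := norm_num)
    simpa [hq] using (this.tendsto 0).mono_left nhdsWithin_le_nhds
  have hq1 (δ : ℝ) (hδ : 0 < δ) : q δ < 1 :=
    Real.rpow_lt_one_of_one_lt_of_neg one_lt_two (by linarith)
  have hq0 (δ : ℝ) : 0 < q δ := by positivity
  have hdiv := tendsto_one_sub_two_rpow_neg_div
  have hlogδ : Tendsto (fun δ => Real.log (1 - q δ) - Real.log δ) (nhdsWithin 0 (Set.Ioi 0))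
      (nhds (Real.log (Real.log 2))) := by
    refine (hdiv.log (Real.log_pos one_lt_two).ne').congr' ?_
    filter_upwards [self_mem_nhdsWithin] with δ hδ
    rw [Real.log_div (sub_pos.2 (hq1 δ hδ)).ne' (ne_of_gt hδ)]
  have hδΦ : Tendsto (fun δ => δ * Φ δ) (nhdsWithin 0 (Set.Ioi 0)) (nhds 0) := by
    have h1 : Tendsto (fun δ : ℝ => δ) (nhdsWithin 0 (Set.Ioi 0)) (nhds 0) :=
      tendsto_id.mono_left nhdsWithin_le_nhds
    have h2 : Tendsto (fun δ : ℝ => Real.log δ * δ) (nhdsWithin 0 (Set.Ioi 0)) (nhds 0) := by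
      simpa using tendsto_log_mul_rpow_nhdsGT_zero one_pos
    have := (h1.mul hL).sub h2
    simp only [zero_mul, sub_zero] at this
    exact this.congr fun δ => by ring
  have hdiff : Tendsto (fun δ => P δ - Φ δ) (nhdsWithin 0 (Set.Ioi 0)) (nhds 0) := by
    have h1 : Tendsto (fun δ => (1 - q δ) / δ * (δ * Φ δ) / q δ) (nhdsWithin 0 (Set.Ioi 0))
        (nhds 0) := by
      have := (hdiv.mul hδΦ).div hqlim one_ne_zero
      rw [mul_zero, zero_div] at this
      exact this
    refine tendsto_of_tendsto_of_tendsto_of_le_of_le' tendsto_const_nhds h1 ?_ ?_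
    · filter_upwards [self_mem_nhdsWithin] with δ hδ using sub_nonneg.2 (hPu δ hδ)
    · filter_upwards [self_mem_nhdsWithin] with δ hδ
      have hδ' : δ ≠ 0 := ne_of_gt hδ
      rw [le_div_iff₀ (hq0 δ), ← mul_assoc, div_mul_cancel₀ _ hδ']
      linarith [hPl δ hδ]
  have habel := (Real.tendsto_tsum_powerSeries_nhdsWithin_lt (tendsto_dyadic_sum_sub hc0 hc1 h)).comp
    (tendsto_nhdsWithin_iff.2 ⟨hqlim, by
      filter_upwards [self_mem_nhdsWithin] with δ hδ using hq1 δ hδ⟩)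
  have hleft : Tendsto (fun δ => P δ + Real.log (1 - q δ)) (nhdsWithin 0 (Set.Ioi 0))
      (nhds (M + Real.log (Real.log 2) - Real.eulerMascheroniConstant)) := by
    have := hqlim.mul habel
    rw [one_mul] at this
    refine this.congr' ?_
    filter_upwards [self_mem_nhdsWithin] with δ hδ
    have h1 := Real.hasSum_pow_div_log_of_abs_lt_one
      (show |q δ| < 1 by rw [abs_of_pos (hq0 δ)]; exact hq1 δ hδ)
    have h2 := (hPsum δ hδ).sub h1
    rw [Function.comp_apply, ← tsum_mul_left, ← sub_neg_eq_add, ← h2.tsum_eq]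
    refine tsum_congr fun k => ?_
    simp only [pow_succ, hq]
    ring
  have hright := (hdiff.add hL).add hlogδ
  have := tendsto_nhds_unique hleft (hright.congr fun δ => by ring)
  linarith

/-- The part of order at least two of the Euler factor at `p` of `log ζ(s)`, extended by zero
to all natural numbers. -/
noncomputable def eulerLogRemainder (s : ℝ) (n : ℕ) : ℝ :=
  if n.Prime then -Real.log (1 - (n : ℝ) ^ (-s)) - (n : ℝ) ^ (-s) else 0

theorem abs_eulerLogRemainder_le {s : ℝ} (hs : 1 ≤ s) (n : ℕ) :
    |eulerLogRemainder s n| ≤ 2 * (1 / (n : ℝ) ^ 2) := by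
  unfold eulerLogRemainder
  split_ifs with hn
  · have hn2 : (2 : ℝ) ≤ n := mod_cast hn.two_le
    set x : ℝ := (n : ℝ) ^ (-s) with hx
    have hx0 : 0 < x := by positivity
    have hxn : x ≤ 1 / n := by
      rw [one_div, ← Real.rpow_neg_one]
      exact Real.rpow_le_rpow_of_exponent_le (by linarith) (by linarith)
    have hx2 : x ≤ 1 / 2 := hxn.trans (one_div_le_one_div_of_le two_pos hn2)
    have h := Real.abs_log_sub_add_sum_range_le
      (show |x| < 1 by rw [abs_of_pos hx0]; linarith) 1
    rw [abs_of_pos hx0] at h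
    have h' : |-Real.log (1 - x) - x| = |∑ i ∈ Finset.range 1, x ^ (i + 1) / ((i : ℝ) + 1) +
        Real.log (1 - x)| := by
      rw [← abs_neg]
      simp
    rw [h']
    refine h.trans ?_
    rw [div_le_iff₀ (by linarith)]
    have : x ^ 2 ≤ 1 / (n : ℝ) ^ 2 := by
      rw [← one_div_pow]
      exact pow_le_pow_left₀ hx0.le hxn 2
    norm_num at this ⊢
    nlinarith
  · simp

theorem summable_two_mul_one_div_sq : Summable fun n : ℕ => 2 * (1 / (n : ℝ) ^ 2) :=
  (Real.summable_one_div_nat_pow.2 one_lt_two).mul_left 2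

theorem summable_eulerLogRemainder {s : ℝ} (hs : 1 ≤ s) : Summable (eulerLogRemainder s) :=
  Summable.of_norm_bounded summable_two_mul_one_div_sq (abs_eulerLogRemainder_le hs)

theorem tendsto_tsum_eulerLogRemainder :
    Tendsto (fun s => ∑' n, eulerLogRemainder s n) (nhdsWithin 1 (Set.Ioi 1))
      (nhds (∑' n, eulerLogRemainder 1 n)) := by
  refine tendsto_tsum_of_dominated_convergence summable_two_mul_one_div_sq (fun n => ?_) ?_
  · unfold eulerLogRemainder
    split_ifs with hn
    · have hn1 : (1 : ℝ) < n := mod_cast hn.one_lt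
      have hx : Tendsto (fun s : ℝ => (n : ℝ) ^ (-s)) (nhdsWithin 1 (Set.Ioi 1))
          (nhds ((n : ℝ) ^ (-1 : ℝ))) := by
        have : Continuous fun s : ℝ => (n : ℝ) ^ (-s) := by
          fun_prop (disch := intros; linarith)
        exact (this.tendsto 1).mono_left nhdsWithin_le_nhds
      have : (n : ℝ) ^ (-1 : ℝ) < 1 := Real.rpow_lt_one_of_one_lt_of_neg hn1 (by norm_num)
      exact ((tendsto_const_nhds.sub hx).log (by linarith)).neg.sub hx
    · exact tendsto_const_nhds
  · filter_upwards [self_mem_nhdsWithin] with s hs n using abs_eulerLogRemainder_le hs.le n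

theorem summable_prime_rpow {s : ℝ} (hs : 1 < s) :
    Summable fun n : ℕ => if n.Prime then (n : ℝ) ^ (-s) else 0 := by
  refine Summable.of_nonneg_of_le (fun n => ?_) (fun n => ?_)
    (Real.summable_nat_rpow.2 (show -s < -1 by linarith))
  all_goals split_ifs <;> first | positivity | rfl

theorem log_riemannZeta_eq_tsum_prime {s : ℝ} (hs : 1 < s) :
    Real.log (riemannZeta s).re = ∑' n : ℕ, (if n.Prime then (n : ℝ) ^ (-s) else 0) +
      ∑' n, eulerLogRemainder s n := by
  have hsum := ((summable_prime_rpow hs).hasSum.add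
    (summable_eulerLogRemainder hs.le).hasSum).tendsto_sum_nat
  refine tendsto_nhds_unique ?_ hsum
  have h1 := (Complex.continuous_re.tendsto _).comp
    (riemannZeta_eulerProduct (s := (s : ℂ)) (by simpa using hs))
  refine (h1.log (riemannZeta_re_pos_of_one_lt hs).ne').congr fun n => ?_
  have hlt (p : ℕ) (hp : p.Prime) : (p : ℝ) ^ (-s) < 1 :=
    Real.rpow_lt_one_of_one_lt_of_neg (mod_cast hp.one_lt) (by linarith)
  have hre : (∏ p ∈ n.primesBelow, (1 - (p : ℂ) ^ (-(s : ℂ)))⁻¹).re =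
      ∏ p ∈ n.primesBelow, (1 - (p : ℝ) ^ (-s))⁻¹ := by
    rw [← Complex.ofReal_re (∏ p ∈ n.primesBelow, (1 - (p : ℝ) ^ (-s))⁻¹)]
    congr 1
    push_cast
    refine Finset.prod_congr rfl fun p _ => ?_
    rw [Complex.ofReal_cpow (by positivity)]
    simp
  rw [Function.comp_apply, hre, Real.log_prod, Nat.primesBelow, Finset.sum_filter]
  · refine Finset.sum_congr rfl fun p _ => ?_
    unfold eulerLogRemainder
    split_ifs
    · rw [Real.log_inv]
      ring
    · simp
  · intro p hp
    have := hlt p (Nat.prime_of_mem_primesBelow hp)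
    exact inv_ne_zero (by linarith)

/-- **Mertens' second theorem**, with the constant. -/
theorem tendsto_sum_inv_sub_log_log :
    Tendsto (fun n : ℕ => ∑ p ∈ n.primesLE, 1 / (p : ℝ) - Real.log (Real.log n))
      atTop (nhds (Real.eulerMascheroniConstant - ∑' n, eulerLogRemainder 1 n)) := by
  obtain ⟨M, hM⟩ := exists_tendsto_sum_inv_sub_log_log
  set c : ℕ → ℝ := fun n => if n.Prime then 1 / (n : ℝ) else 0 with hc
  have hc_nonneg (n : ℕ) : 0 ≤ c n := by
    simp only [hc]
    split_ifs <;> positivity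
  have hc_lim : Tendsto c atTop (nhds 0) := by
    refine squeeze_zero hc_nonneg (fun n => ?_) tendsto_one_div_atTop_nhds_zero_nat
    simp only [hc]
    split_ifs
    · rfl
    · positivity
  have hpart : Tendsto (fun n : ℕ => ∑ i ∈ Finset.range n, c i - Real.log (Real.log n))
      atTop (nhds M) := by
    have := hM.sub hc_lim
    rw [sub_zero] at this
    refine this.congr fun n => ?_
    rw [Nat.primesLE_eq_filter_range, Finset.sum_filter, Finset.sum_range_succ]
    ring
  have hΦ (δ : ℝ) (hδ : 0 < δ) : HasSum (fun n : ℕ => c n * (n : ℝ) ^ (-δ))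
      (∑' n : ℕ, if n.Prime then (n : ℝ) ^ (-(1 + δ)) else 0) := by
    convert (summable_prime_rpow (show 1 < 1 + δ by linarith)).hasSum using 2 with n
    simp only [hc]
    split_ifs with hn
    · have : (0 : ℝ) < n := mod_cast hn.pos
      rw [neg_add, Real.rpow_add this, Real.rpow_neg_one, one_div]
    · simp
  have hshift : Tendsto (fun δ : ℝ => 1 + δ) (nhdsWithin 0 (Set.Ioi 0))
      (nhdsWithin 1 (Set.Ioi 1)) := by
    refine tendsto_nhdsWithin_iff.2 ⟨?_, ?_⟩
    · have : Continuous fun δ : ℝ => 1 + δ := by fun_prop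
      simpa using (this.tendsto 0).mono_left nhdsWithin_le_nhds
    · filter_upwards [self_mem_nhdsWithin] with δ hδ
      simpa using hδ
  have hL : Tendsto (fun δ : ℝ => (∑' n : ℕ, if n.Prime then (n : ℝ) ^ (-(1 + δ)) else 0) +
      Real.log δ) (nhdsWithin 0 (Set.Ioi 0)) (nhds (-∑' n, eulerLogRemainder 1 n)) := by
    have h1 := (Asymptotics.isLittleO_one_iff ℝ).1 log_riemannZeta_add_log_sub_isLittleO_ofReal
    have h2 := (h1.sub tendsto_tsum_eulerLogRemainder).comp hshift
    rw [zero_sub] at h2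
    refine h2.congr' ?_
    filter_upwards [self_mem_nhdsWithin] with δ hδ
    have hδ' : (0 : ℝ) < δ := hδ
    simp only [Function.comp_apply]
    rw [log_riemannZeta_eq_tsum_prime (show 1 < 1 + δ by linarith)]
    simp only [add_sub_cancel_left]
    ring
  have := const_eq_of_tendsto_dirichlet hc_nonneg (by simp [hc]) (by simp [hc, Nat.not_prime_one])
    hpart hΦ hL
  rwa [this, ← sub_eq_add_neg] at hM

/-- **Mertens' third theorem**. -/
theorem tendsto_log_mul_prod_one_sub_inv :
    Tendsto (fun n : ℕ => Real.log n * ∏ p ∈ n.primesLE, (1 - 1 / (p : ℝ)))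
      atTop (nhds (Real.exp (-Real.eulerMascheroniConstant))) := by
  have h1 := tendsto_sum_inv_sub_log_log.add
    ((summable_eulerLogRemainder le_rfl).hasSum.tendsto_sum_nat.comp (tendsto_add_atTop_nat 1))
  rw [sub_add_cancel] at h1
  refine (Real.continuous_exp.tendsto _ |>.comp h1.neg).congr' ?_
  filter_upwards [eventually_ge_atTop 2] with n hn
  have hlog : 0 < Real.log n := Real.log_pos (mod_cast hn)
  have hpos (p : ℕ) (hp : p ∈ n.primesLE) : 0 < 1 - 1 / (p : ℝ) := by
    have : (1 : ℝ) < p := mod_cast Nat.one_lt_of_mem_primesLE hp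
    rw [sub_pos, div_lt_one (by linarith)]
    exact this
  have hrem : ∑ i ∈ Finset.range (n + 1), eulerLogRemainder 1 i =
      ∑ p ∈ n.primesLE, (-Real.log (1 - 1 / (p : ℝ)) - 1 / (p : ℝ)) := by
    rw [Nat.primesLE_eq_filter_range, Finset.sum_filter]
    simp [eulerLogRemainder, Real.rpow_neg_one]
  rw [← Real.exp_log (mul_pos hlog (Finset.prod_pos hpos)), Real.log_mul hlog.ne'
    (Finset.prod_pos hpos).ne', Real.log_prod fun p hp => (hpos p hp).ne']
  simp only [Function.comp_apply, hrem, Finset.sum_sub_distrib, Finset.sum_neg_distrib]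
  congr 1
  ring

theorem tendsto_prod_twinPrimeConstant :
    Tendsto (fun n : ℕ => ∏ p ∈ (Finset.range (n + 1)).filter (fun p => p.Prime ∧ 2 < p),
      (1 - 1 / ((p : ℝ) - 1) ^ 2)) atTop (nhds twinPrimeConstant) := by
  set F : ℕ → ℝ := fun n => if n.Prime ∧ 2 < n then 1 - 1 / ((n : ℝ) - 1) ^ 2 else 1 with hF
  have hmul : Multipliable F := by
    have hsum : Summable fun n : ℕ => if n.Prime ∧ 2 < n then -(1 / ((n : ℝ) - 1) ^ 2) else 0 := by
      refine Summable.of_norm_bounded (g := fun n : ℕ => 4 * (1 / (n : ℝ) ^ 2))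
        ((Real.summable_one_div_nat_pow.2 one_lt_two).mul_left 4) fun n => ?_
      split_ifs with hn
      · have : (2 : ℝ) < n := mod_cast hn.2
        have h1 : (0 : ℝ) < ((n : ℝ) - 1) ^ 2 := by nlinarith
        rw [norm_neg, Real.norm_of_nonneg (by positivity), mul_one_div,
          div_le_div_iff₀ h1 (by positivity)]
        nlinarith
      · simp
    refine (Real.multipliable_one_add_of_summable hsum).congr fun n => ?_
    simp only [hF]
    split_ifs <;> ring
  let i : {p : Nat.Primes // 2 < (p : ℕ)} → ℕ := fun p => p
  have hi : Function.Injective i := fun p q h => Subtype.ext (Subtype.ext h)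
  have htprod : twinPrimeConstant = ∏' n, F n := by
    rw [twinPrimeConstant, ← hi.tprod_eq]
    · exact tprod_congr fun p => by simp [hF, i, p.1.2, p.2]
    · intro n hn
      by_contra h
      exact hn (if_neg fun hn' => h ⟨⟨⟨n, hn'.1⟩, hn'.2⟩, rfl⟩)
  rw [htprod]
  refine (hmul.hasProd.tendsto_prod_nat.comp (tendsto_add_atTop_nat 1)).congr fun n => ?_
  rw [Finset.prod_filter]
  rfl

theorem prod_one_sub_two_div {N : ℕ} (hN : 2 ≤ N) :
    ∏ p ∈ (Finset.range (N + 1)).filter (fun p => p.Prime ∧ 2 < p), (1 - 2 / (p : ℝ)) =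
      4 * (∏ p ∈ N.primesLE, (1 - 1 / (p : ℝ))) ^ 2 *
        ∏ p ∈ (Finset.range (N + 1)).filter (fun p => p.Prime ∧ 2 < p),
          (1 - 1 / ((p : ℝ) - 1) ^ 2) := by
  have hins : N.primesLE = insert 2
      ((Finset.range (N + 1)).filter (fun p : ℕ => p.Prime ∧ 2 < p)) := by
    ext p
    simp only [Nat.mem_primesLE, Finset.mem_insert, Finset.mem_filter, Finset.mem_range]
    constructor
    · rintro ⟨h1, h2⟩
      have := h2.two_le
      rcases this.eq_or_lt with h | h
      · exact Or.inl h.symm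
      · exact Or.inr ⟨by lia, h2, h⟩
    · rintro (rfl | ⟨h1, h2, -⟩)
      · exact ⟨hN, Nat.prime_two⟩
      · exact ⟨by lia, h2⟩
  rw [hins, Finset.prod_insert (by simp), mul_pow, ← Finset.prod_pow, ← mul_assoc, mul_assoc,
    ← Finset.prod_mul_distrib]
  norm_num
  refine Finset.prod_congr rfl fun p hp => ?_
  have h2 : (2 : ℝ) < p := mod_cast (Finset.mem_filter.1 hp).2.2
  have h0 : (p : ℝ) ≠ 0 := by linarith
  have h1 : (p : ℝ) - 1 ≠ 0 := by linarith
  field_simp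
  ring

theorem Nat.tendsto_sqrt_atTop : Tendsto Nat.sqrt atTop atTop :=
  tendsto_atTop.2 fun b => by
    filter_upwards [eventually_ge_atTop (b * b)] with n hn using Nat.le_sqrt.2 hn

theorem tendsto_log_div_log_sqrt :
    Tendsto (fun n : ℕ => Real.log n / Real.log (Nat.sqrt n)) atTop (nhds 2) := by
  have hlog : Tendsto (fun n : ℕ => Real.log (Nat.sqrt n)) atTop atTop :=
    Real.tendsto_log_atTop.comp (tendsto_natCast_atTop_atTop.comp Nat.tendsto_sqrt_atTop)
  have hup : Tendsto (fun n : ℕ => 2 + 2 * Real.log 2 / Real.log (Nat.sqrt n)) atTop (nhds 2) := by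
    simpa using (hlog.const_div_atTop (2 * Real.log 2)).const_add 2
  have hbounds : ∀ᶠ n : ℕ in atTop, 0 < Real.log (Nat.sqrt n) ∧
      2 * Real.log (Nat.sqrt n) ≤ Real.log n ∧
      Real.log n ≤ 2 * Real.log 2 + 2 * Real.log (Nat.sqrt n) := by
    filter_upwards [Nat.tendsto_sqrt_atTop.eventually_ge_atTop 2] with n hN
    have hN' : (2 : ℝ) ≤ Nat.sqrt n := mod_cast hN
    have h1 : (Nat.sqrt n : ℝ) ^ 2 ≤ n := mod_cast Nat.sqrt_le' n
    have h2 : (n : ℝ) ≤ (2 * Nat.sqrt n) ^ 2 := by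
      have : (n : ℝ) < (Nat.sqrt n + 1) ^ 2 := mod_cast Nat.lt_succ_sqrt' n
      nlinarith
    refine ⟨Real.log_pos (by linarith), ?_, ?_⟩
    · have := Real.log_le_log (by positivity) h1
      rwa [Real.log_pow] at this
    · have := Real.log_le_log (by nlinarith) h2
      rw [Real.log_pow, Real.log_mul (by norm_num) (by linarith)] at this
      push_cast at this
      linarith
  refine tendsto_of_tendsto_of_tendsto_of_le_of_le' tendsto_const_nhds hup ?_ ?_
  · filter_upwards [hbounds] with n hn
    rw [le_div_iff₀ hn.1]
    exact hn.2.1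
  · filter_upwards [hbounds] with n hn
    rw [div_le_iff₀ hn.1, add_mul, div_mul_cancel₀ _ hn.1.ne']
    linarith [hn.2.2]

open scoped Classical in
/-- Mertens-type asymptotic: `(log n)² · ∏_{2 < p ≤ √n} (1 − 2/p) → 16·A·e^{−2γ}`,
the product running over odd primes `p ≤ √n`. -/
theorem mertens_brun :
    Tendsto
      (fun n : ℕ => (Real.log n) ^ 2 *
        ∏ p ∈ (Finset.range (n + 1)).filter
            (fun p : ℕ => Nat.Prime p ∧ 2 < p ∧ (p : ℝ) ≤ Real.sqrt n),
          (1 - 2 / (p : ℝ)))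
      atTop
      (nhds (16 * twinPrimeConstant *
        Real.exp (-(2 * Real.eulerMascheroniConstant)))) := by
  have h := (((tendsto_log_div_log_sqrt.pow 2).const_mul 4).mul
    ((tendsto_log_mul_prod_one_sub_inv.comp Nat.tendsto_sqrt_atTop).pow 2)).mul
    (tendsto_prod_twinPrimeConstant.comp Nat.tendsto_sqrt_atTop)
  have hval : 4 * (2 : ℝ) ^ 2 * Real.exp (-Real.eulerMascheroniConstant) ^ 2 * twinPrimeConstant =
      16 * twinPrimeConstant * Real.exp (-(2 * Real.eulerMascheroniConstant)) := by
    rw [← Real.exp_nat_mul]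
    push_cast
    rw [mul_neg]
    ring
  rw [hval] at h
  refine h.congr' ?_
  filter_upwards [Nat.tendsto_sqrt_atTop.eventually_ge_atTop 2] with n hN
  have hset : (Finset.range (n + 1)).filter
      (fun p : ℕ => Nat.Prime p ∧ 2 < p ∧ (p : ℝ) ≤ Real.sqrt n) =
      (Finset.range (Nat.sqrt n + 1)).filter (fun p => p.Prime ∧ 2 < p) := by
    ext p
    have hle : (p : ℝ) ≤ Real.sqrt n ↔ p ≤ Nat.sqrt n := by
      rw [← Real.nat_floor_real_sqrt_eq_nat_sqrt, Nat.le_floor_iff (Real.sqrt_nonneg _)]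
    have := Nat.sqrt_le_self n
    simp only [Finset.mem_filter, Finset.mem_range, hle]
    constructor
    · rintro ⟨-, h1, h2, h3⟩
      exact ⟨by lia, h1, h2⟩
    · rintro ⟨h1, h2, h3⟩
      exact ⟨by lia, h2, h3, by lia⟩
  have hlog : Real.log (Nat.sqrt n) ≠ 0 := (Real.log_pos (mod_cast hN)).ne'
  rw [hset]
  have hprod := prod_one_sub_two_div hN
  simp only [Function.comp_apply]
  convert congrArg (Real.log n ^ 2 * ·) hprod.symm using 1
  · field_simp
end

section
/- Suppose (a_q)_{q≥1} are complex numbers and a : ℕ → ℂ satisfies a(n) = Σ_{q=1}^∞ Σ_{k=1, gcd(k,q)=1}^{q} a_q e^{2πi(k/q)n} with Σ_{q=1}^∞ |a_q|·φ(q) < ∞. Then for every complex x with |x| < 1, Σ_{n=1}^∞ a(n) xⁿ = Σ_{q=1}^∞ Σ_{k=1, gcd(k,q)=1}^{q} a_q · (e^{2πik/q} x)/(1 − e^{2πik/q} x). -/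
open Finset

theorem card_filter_gcd_eq_totient (q : ℕ) :
    ((Finset.Icc 1 q).filter (fun k => Nat.gcd k q = 1)).card = Nat.totient q := by
  rw [← Nat.filter_coprime_Ico_eq_totient q 1]
  congr 1
  ext k
  simp only [Finset.mem_filter, Finset.mem_Icc, Finset.mem_Ico, Nat.Coprime, Nat.gcd_comm q k]
  omega

theorem norm_exp_two_pi_I_mul_div (k q : ℕ) :
    ‖Complex.exp (2 * Real.pi * Complex.I * (k / q : ℂ))‖ = 1 := by
  have h : (2 * Real.pi * Complex.I * (k / q : ℂ)) =
      ((2 * Real.pi * (k / q) : ℝ) : ℂ) * Complex.I := by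
    push_cast
    ring
  rw [h, Complex.norm_exp_ofReal_mul_I]

/-- The power series of `y / (1 - y)`, starting at exponent one. -/
theorem hasSum_pow_succ_of_norm_lt_one {y : ℂ} (hy : ‖y‖ < 1) :
    HasSum (fun n : ℕ => y ^ (n + 1)) (y / (1 - y)) := by
  simpa only [pow_succ', div_eq_mul_inv] using (hasSum_geometric_of_norm_lt_one hy).mul_left y

/-- Interchange of summation for power series whose coefficients are absolutely convergent
combinations of powers of points on the unit circle. -/
theorem tsum_tsum_mul_pow_succ {ι : Type*} (s : ℕ → Finset ι) (z : ℕ → ι → ℂ) (c : ℕ → ℂ)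
    (hz : ∀ q, ∀ k ∈ s q, ‖z q k‖ = 1)
    (hc : Summable (fun q => ‖c q‖ * ((s q).card : ℝ))) {x : ℂ} (hx : ‖x‖ < 1) :
    ∑' n : ℕ, ∑' q : ℕ, ∑ k ∈ s q, c q * (z q k * x) ^ (n + 1) =
      ∑' q : ℕ, ∑ k ∈ s q, c q * ((z q k * x) / (1 - z q k * x)) := by
  have hgeom : Summable (fun n : ℕ => ‖x‖ ^ (n + 1)) :=
    (summable_nat_add_iff 1).2 (summable_geometric_of_lt_one (norm_nonneg x) hx)
  have hprod : Summable (Function.uncurry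
      (fun n q : ℕ => ∑ k ∈ s q, c q * (z q k * x) ^ (n + 1))) := by
    refine Summable.of_norm_bounded (hgeom.mul_of_nonneg hc (fun n => by positivity)
      (fun q => by positivity)) ?_
    rintro ⟨n, q⟩
    calc ‖∑ k ∈ s q, c q * (z q k * x) ^ (n + 1)‖
        ≤ ∑ k ∈ s q, ‖c q‖ * ‖x‖ ^ (n + 1) := by
          refine norm_sum_le_of_le _ fun k hk => ?_
          rw [norm_mul, norm_pow, norm_mul, hz q k hk, one_mul]
      _ = ‖x‖ ^ (n + 1) * (‖c q‖ * ((s q).card : ℝ)) := by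
          rw [Finset.sum_const, nsmul_eq_mul]
          ring
  rw [← hprod.tsum_comm]
  refine tsum_congr fun q => (hasSum_sum fun k hk => ?_).tsum_eq
  refine (hasSum_pow_succ_of_norm_lt_one ?_).mul_left (c q)
  rwa [norm_mul, hz q k hk, one_mul]

/-- If `a(n) = ∑_{q=1}^∞ ∑_{k=1, gcd(k,q)=1}^{q} a_q e^{2πi(k/q)n}` with
`∑_q |a_q| φ(q) < ∞`, then for `|x| < 1`,
`∑_{n=1}^∞ a(n) xⁿ = ∑_q ∑_{k, gcd(k,q)=1} a_q (e^{2πik/q} x)/(1 − e^{2πik/q} x)`: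
the generating function of `a` has simple poles at the rational points of the
unit circle. (All series over `q` run over `q ≥ 1`; the `q = 0` terms vanish
since `φ(0) = 0` and the inner sum over `k` is empty.) -/
theorem generatingFunction_ramanujanFourier (a : ℕ → ℂ) (aq : ℕ → ℂ)
    (hsum : Summable (fun q : ℕ => ‖aq q‖ * (Nat.totient q : ℝ)))
    (ha : ∀ n : ℕ, 1 ≤ n →
      HasSum (fun q : ℕ =>
        ∑ k ∈ (Finset.Icc 1 q).filter (fun k => Nat.gcd k q = 1),
          aq q * Complex.exp (2 * Real.pi * Complex.I * (k / q : ℂ) * n)) (a n)) :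
    ∀ x : ℂ, ‖x‖ < 1 →
      (∑' n : ℕ, a (n + 1) * x ^ (n + 1)) =
        ∑' q : ℕ, ∑ k ∈ (Finset.Icc 1 q).filter (fun k => Nat.gcd k q = 1),
          aq q * ((Complex.exp (2 * Real.pi * Complex.I * (k / q : ℂ)) * x) /
            (1 - Complex.exp (2 * Real.pi * Complex.I * (k / q : ℂ)) * x)) := by
  intro x hx
  rw [← tsum_tsum_mul_pow_succ (fun q => (Finset.Icc 1 q).filter (fun k => Nat.gcd k q = 1))
    (fun q k => Complex.exp (2 * Real.pi * Complex.I * (k / q : ℂ))) aq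
    (fun q k _ => norm_exp_two_pi_I_mul_div k q)
    (by simpa only [card_filter_gcd_eq_totient] using hsum) hx]
  refine tsum_congr fun n => ?_
  rw [← ((ha (n + 1) n.succ_pos).mul_right (x ^ (n + 1))).tsum_eq]
  refine tsum_congr fun q => ?_
  rw [Finset.sum_mul]
  refine Finset.sum_congr rfl fun k _ => ?_
  rw [mul_pow, ← Complex.exp_nat_mul, mul_assoc, mul_comm ((n + 1 : ℕ) : ℂ)]
end
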